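/- Let k ≥ 3 be an integer and let λ = (k, k, 1). Then for any number of variables n ≥ 3, the symmetric polynomial (s_λ^{(1)})^2 − s_λ · s_λ^{(2)} in the variables x_1,…,x_n is Schur positive. -/

import Mathlib

open MvPolynomial

noncomputable section

/-- The complete homogeneous symmetric polynomial in `n` variables, indexed by an
integer (by convention it is `0` for negative indices). -/
def hInt (n : ℕ) (k : ℤ) : MvPolynomial (Fin n) ℚ :=
  if 0 ≤ k then MvPolynomial.hsymm (Fin n) ℚ k.toNat else 0

/-- The number of (nonzero) parts of a partition `lam : ℕ → ℕ` (parts are indexed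
starting from `0`). -/
def partLen (lam : ℕ → ℕ) : ℕ := sInf {N | lam N = 0}

/-- A partition, recorded as a weakly decreasing, eventually zero function `ℕ → ℕ`
listing its parts (indexed starting from `0`). -/
def IsPartition (lam : ℕ → ℕ) : Prop := Antitone lam ∧ ∃ N, ∀ i, N ≤ i → lam i = 0

/-- The Schur polynomial of a partition in `n` variables, via the Jacobi-Trudi identity
`s_lam = det (h_{lam_i + j - i})`. -/
def schur (n : ℕ) (lam : ℕ → ℕ) : MvPolynomial (Fin n) ℚ :=
  (Matrix.of fun i j : Fin (partLen lam) =>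
    hInt n ((lam i : ℤ) + ((j : ℕ) : ℤ) - ((i : ℕ) : ℤ))).det

/-- The `i`-th derived polynomial `p^{(i)}` of `p`, defined by the identity
`p (x₁ + t, …, xₙ + t) = ∑ i, t^i • p^{(i)} (x₁, …, xₙ)`: substituting `X j + t` for each
variable `X j` yields a polynomial in `t` whose `t^i`-coefficient is `p^{(i)}`. -/
def derived (n i : ℕ) (p : MvPolynomial (Fin n) ℚ) : MvPolynomial (Fin n) ℚ :=
  (MvPolynomial.aeval
    (fun j : Fin n => (Polynomial.C (X j) + Polynomial.X : Polynomial (MvPolynomial (Fin n) ℚ)))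
    p).coeff i

/-- A symmetric polynomial is Schur positive if it is a linear combination of Schur
polynomials (of partitions) with non-negative coefficients. -/
def SchurPositive (n : ℕ) (f : MvPolynomial (Fin n) ℚ) : Prop :=
  ∃ (S : Finset (ℕ → ℕ)) (c : (ℕ → ℕ) → ℚ),
    (∀ μ ∈ S, IsPartition μ) ∧ (∀ μ ∈ S, 0 ≤ c μ) ∧ f = ∑ μ ∈ S, c μ • schur n μ

section ShiftDifferences

variable {R : Type*} [CommRing R]

def diff13 (f : ℤ → ℤ → ℤ → ℤ → R) (a b c d : ℤ) : R := f a b c d - f (a + 1) b (c - 1) d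
def diff14 (f : ℤ → ℤ → ℤ → ℤ → R) (a b c d : ℤ) : R := f a b c d - f (a + 1) b c (d - 1)
def diff23 (f : ℤ → ℤ → ℤ → ℤ → R) (a b c d : ℤ) : R := f a b c d - f a (b + 1) (c - 1) d
def diff24 (f : ℤ → ℤ → ℤ → ℤ → R) (a b c d : ℤ) : R := f a b c d - f a (b + 1) c (d - 1)

/-- The product of the four lowering differences between the pairs `{a, b}` and `{c, d}`. -/
def crossDiff (f : ℤ → ℤ → ℤ → ℤ → R) : ℤ → ℤ → ℤ → ℤ → R :=
  diff24 (diff14 (diff13 (diff23 f)))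

theorem crossDiff_eq (f : ℤ → ℤ → ℤ → ℤ → R) :
    crossDiff f = diff23 (diff14 (diff13 (diff24 f))) := by
  funext a b c d
  simp only [crossDiff, diff13, diff14, diff23, diff24]
  ring_nf

/-- `f a b c d` vanishes once `c` or `d` is smaller than `B`. -/
def VanishesBelow (B : ℤ) (f : ℤ → ℤ → ℤ → ℤ → R) : Prop :=
  ∀ a b c d, c < B ∨ d < B → f a b c d = 0

theorem VanishesBelow.diff13 {B : ℤ} {f : ℤ → ℤ → ℤ → ℤ → R} (hf : VanishesBelow B f) :
    VanishesBelow B (diff13 f) := fun a b c d h => by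
  rw [_root_.diff13, hf _ _ _ _ h, hf _ _ _ _ (by omega), sub_zero]

theorem VanishesBelow.diff14 {B : ℤ} {f : ℤ → ℤ → ℤ → ℤ → R} (hf : VanishesBelow B f) :
    VanishesBelow B (diff14 f) := fun a b c d h => by
  rw [_root_.diff14, hf _ _ _ _ h, hf _ _ _ _ (by omega), sub_zero]

theorem VanishesBelow.diff23 {B : ℤ} {f : ℤ → ℤ → ℤ → ℤ → R} (hf : VanishesBelow B f) :
    VanishesBelow B (diff23 f) := fun a b c d h => by
  rw [_root_.diff23, hf _ _ _ _ h, hf _ _ _ _ (by omega), sub_zero]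

theorem VanishesBelow.diff24 {B : ℤ} {f : ℤ → ℤ → ℤ → ℤ → R} (hf : VanishesBelow B f) :
    VanishesBelow B (diff24 f) := fun a b c d h => by
  rw [_root_.diff24, hf _ _ _ _ h, hf _ _ _ _ (by omega), sub_zero]

theorem VanishesBelow.crossDiff {B : ℤ} {f : ℤ → ℤ → ℤ → ℤ → R} (hf : VanishesBelow B f) :
    VanishesBelow B (crossDiff f) := hf.diff23.diff13.diff14.diff24

theorem sum_range_telescope (g : ℕ → R) {N : ℕ} (hg : g N = 0) :
    g 0 = ∑ i ∈ Finset.range N, (g i - g (i + 1)) := by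
  rw [Finset.sum_range_sub', hg, sub_zero]

theorem eq_sum_diff13 {B : ℤ} {f : ℤ → ℤ → ℤ → ℤ → R} (hf : VanishesBelow B f) (a b c d : ℤ)
    {N : ℕ} (hN : c - N < B) :
    f a b c d = ∑ i ∈ Finset.range N, diff13 f (a + i) b (c - i) d := by
  have := sum_range_telescope (fun i : ℕ => f (a + i) b (c - i) d) (hf _ _ _ _ (Or.inl hN))
  simp only [Nat.cast_zero, add_zero, sub_zero] at this
  rw [this]
  refine Finset.sum_congr rfl fun i _ => ?_
  rw [diff13]; push_cast; ring_nf

theorem eq_sum_diff14 {B : ℤ} {f : ℤ → ℤ → ℤ → ℤ → R} (hf : VanishesBelow B f) (a b c d : ℤ)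
    {N : ℕ} (hN : d - N < B) :
    f a b c d = ∑ i ∈ Finset.range N, diff14 f (a + i) b c (d - i) := by
  have := sum_range_telescope (fun i : ℕ => f (a + i) b c (d - i)) (hf _ _ _ _ (Or.inr hN))
  simp only [Nat.cast_zero, add_zero, sub_zero] at this
  rw [this]
  refine Finset.sum_congr rfl fun i _ => ?_
  rw [diff14]; push_cast; ring_nf

theorem eq_sum_diff23 {B : ℤ} {f : ℤ → ℤ → ℤ → ℤ → R} (hf : VanishesBelow B f) (a b c d : ℤ)
    {N : ℕ} (hN : c - N < B) :
    f a b c d = ∑ i ∈ Finset.range N, diff23 f a (b + i) (c - i) d := by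
  have := sum_range_telescope (fun i : ℕ => f a (b + i) (c - i) d) (hf _ _ _ _ (Or.inl hN))
  simp only [Nat.cast_zero, add_zero, sub_zero] at this
  rw [this]
  refine Finset.sum_congr rfl fun i _ => ?_
  rw [diff23]; push_cast; ring_nf

theorem eq_sum_diff24 {B : ℤ} {f : ℤ → ℤ → ℤ → ℤ → R} (hf : VanishesBelow B f) (a b c d : ℤ)
    {N : ℕ} (hN : d - N < B) :
    f a b c d = ∑ i ∈ Finset.range N, diff24 f a (b + i) c (d - i) := by
  have := sum_range_telescope (fun i : ℕ => f a (b + i) c (d - i)) (hf _ _ _ _ (Or.inr hN))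
  simp only [Nat.cast_zero, add_zero, sub_zero] at this
  rw [this]
  refine Finset.sum_congr rfl fun i _ => ?_
  rw [diff24]; push_cast; ring_nf

theorem sum_range_eq_of_vanish {g : ℕ → R} {N : ℕ} (hg : ∀ i, N ≤ i → g i = 0) {M : ℕ}
    (h : N ≤ M) : ∑ i ∈ Finset.range M, g i = ∑ i ∈ Finset.range N, g i :=
  Finset.eventually_constant_sum hg h

theorem sum_range_range_antisymm [IsAddTorsionFree R] {g : ℕ → ℕ → R} (hg : ∀ i j, g i j = -g j i)
    (N : ℕ) : ∑ i ∈ Finset.range N, ∑ j ∈ Finset.range N, g i j = 0 := by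
  rw [← self_eq_neg]
  conv_lhs => rw [Finset.sum_comm]
  simp only [← Finset.sum_neg_distrib]
  exact Finset.sum_congr rfl fun i _ => Finset.sum_congr rfl fun j _ => hg j i

theorem sum_range_range_antisymm_tail [IsAddTorsionFree R] {g : ℕ → ℕ → R} {N s : ℕ}
    (h1 : ∀ i j, N ≤ i → g i j = 0) (h2 : ∀ i j, g (s + i) j = -g (s + j) i) :
    ∑ i ∈ Finset.range N, ∑ j ∈ Finset.range N, g i j =
      ∑ i ∈ Finset.range s, ∑ j ∈ Finset.range N, g i j := by
  rw [← sum_range_eq_of_vanish (N := N) (M := s + N) _ (by omega), Finset.sum_range_add,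
    sum_range_range_antisymm h2, add_zero]
  exact fun i hi => Finset.sum_eq_zero fun j _ => h1 i j hi

theorem sum_range_ite_lt {g : ℕ → R} {N s : ℕ} (hg : ∀ i, N ≤ i → g i = 0) :
    ∑ i ∈ Finset.range N, (if i < s then g i else 0) = ∑ i ∈ Finset.range s, g i := by
  rw [← sum_range_eq_of_vanish (N := N) (M := s + N) (fun i hi => by simp [hg i hi]) (by omega),
    ← Finset.sum_filter]
  refine Finset.sum_congr ?_ fun _ _ => rfl
  ext i; simp only [Finset.mem_filter, Finset.mem_range]; omega

variable [IsAddTorsionFree R] {B : ℤ} {P : ℤ → ℤ → ℤ → ℤ → R}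

theorem diff23_eq_sum (hP : VanishesBelow B P)
    (h12 : ∀ a b c d, crossDiff P a b c d = -crossDiff P (b - 1) (a + 1) c d)
    (h34 : ∀ a b c d, crossDiff P a b c d = -crossDiff P a b (d - 1) (c + 1))
    {a b c d : ℤ} {e f N : ℕ} (hab : a = b + e) (hcd : c = d + f) (hN : c - N < B) :
    diff23 P a b c d = ∑ l ∈ Finset.range N, ∑ i ∈ Finset.range (l + 1 + f),
      if l ≤ i + e then ∑ j ∈ Finset.range N, crossDiff P (a + i + j) (b + l) (c - i) (d - j - l)
      else 0 := by
  have hv := hP.crossDiff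
  set S := crossDiff P with hS
  have hdN : d - N < B := by omega
  have start : diff23 P a b c d = ∑ i ∈ Finset.range N, ∑ j ∈ Finset.range N,
      ∑ l ∈ Finset.range N, S (a + i + j) (b + l) (c - i) (d - j - l) := by
    rw [eq_sum_diff13 hP.diff23 a b c d hN]
    refine Finset.sum_congr rfl fun i _ => ?_
    rw [eq_sum_diff14 hP.diff23.diff13 _ _ _ _ hdN]
    refine Finset.sum_congr rfl fun j _ => ?_
    rw [eq_sum_diff24 hP.diff23.diff13.diff14 _ _ _ _ (N := N) (by omega)]
    rfl
  rw [start]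
  have key1 : ∀ i ∈ Finset.range N, ∑ j ∈ Finset.range N,
      ∑ l ∈ Finset.range N, S (a + i + j) (b + l) (c - i) (d - j - l) =
      ∑ l ∈ Finset.range N, if l ≤ i + e then
        ∑ j ∈ Finset.range N, S (a + i + j) (b + l) (c - i) (d - j - l) else 0 := by
    intro i _
    rw [Finset.sum_comm, sum_range_range_antisymm_tail (s := i + e + 1)]
    · rw [← sum_range_ite_lt (N := N)]
      · exact Finset.sum_congr rfl fun l _ => by simp only [Nat.lt_succ_iff]
      · exact fun l hl => Finset.sum_eq_zero fun j _ => hv _ _ _ _ (Or.inr (by omega))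
    · exact fun l j hl => hv _ _ _ _ (Or.inr (by omega))
    · intro l j
      rw [h12]
      congr 2 <;> push_cast <;> omega
  rw [Finset.sum_congr rfl key1, Finset.sum_comm]
  refine Finset.sum_congr rfl fun l _ => ?_
  have key2 := sum_range_range_antisymm_tail (N := N) (s := l + 1 + f)
    (g := fun i j => if l ≤ i + e then S (a + i + j) (b + l) (c - i) (d - j - l) else 0) ?_ ?_
  · simpa only [Finset.sum_ite_irrel, Finset.sum_const_zero] using key2
  · intro i j hi
    rw [hv _ _ _ _ (Or.inl (by omega)), ite_self]
  · intro i j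
    rw [if_pos (by omega), if_pos (by omega), h34]
    congr 2 <;> push_cast <;> omega

theorem diff24_eq_sum (hP : VanishesBelow B P)
    (h12 : ∀ a b c d, crossDiff P a b c d = -crossDiff P (b - 1) (a + 1) c d)
    (h34 : ∀ a b c d, crossDiff P a b c d = -crossDiff P a b (d - 1) (c + 1))
    {a b c d : ℤ} {f N : ℕ} (hab : a = b + 1) (hcd : c = d + f) (hN : c - N < B) :
    diff24 P a b c d =
      ∑ l ∈ Finset.range (f + 1), ∑ i ∈ Finset.range (f + 1 - l), ∑ j ∈ Finset.range N,
        crossDiff P (a + i + j) (b + l) (c - i - l) (d - j) +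
      ∑ j ∈ Finset.range N, ∑ i ∈ Finset.range f, ∑ t ∈ Finset.range N,
        crossDiff P (a + i + j) (b + j + f + 2 + t) (c - i - j - f - 2 - t) (d - j) := by
  have hv := hP.crossDiff
  have start : diff24 P a b c d = ∑ i ∈ Finset.range N, ∑ j ∈ Finset.range N,
      ∑ l ∈ Finset.range N, crossDiff P (a + i + j) (b + l) (c - i - l) (d - j) := by
    rw [eq_sum_diff13 hP.diff24 a b c d hN]
    refine Finset.sum_congr rfl fun i _ => ?_
    rw [eq_sum_diff14 hP.diff24.diff13 _ _ _ _ (N := N) (by omega)]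
    refine Finset.sum_congr rfl fun j _ => ?_
    rw [eq_sum_diff23 hP.diff24.diff13.diff14 _ _ _ _ (N := N) (by omega), crossDiff_eq]
  set S := crossDiff P with hS
  have key : ∀ l ∈ Finset.range N, ∑ i ∈ Finset.range N, ∑ j ∈ Finset.range N,
      S (a + i + j) (b + l) (c - i - l) (d - j) =
      (if l < f + 1 then ∑ i ∈ Finset.range (f + 1 - l), ∑ j ∈ Finset.range N,
        S (a + i + j) (b + l) (c - i - l) (d - j) else 0) +
      ∑ j ∈ Finset.range N, if j + f + 2 ≤ l then ∑ i ∈ Finset.range N,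
        S (a + i + j) (b + l) (c - i - l) (d - j) else 0 := by
    intro l _
    by_cases hl : l < f + 1
    · have hz : ∑ j ∈ Finset.range N, (if j + f + 2 ≤ l then ∑ i ∈ Finset.range N,
          S (a + i + j) (b + l) (c - i - l) (d - j) else 0) = 0 :=
        Finset.sum_eq_zero fun j _ => if_neg (by omega)
      rw [hz, add_zero, if_pos hl, sum_range_range_antisymm_tail (s := f + 1 - l)]
      · exact fun i j hi => hv _ _ _ _ (Or.inl (by omega))
      · intro i j
        rw [h34]
        congr 2 <;> push_cast [Nat.cast_sub hl.le] <;> omega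
    · rw [if_neg hl, Finset.sum_comm, sum_range_range_antisymm_tail (s := l - 1 - f), zero_add]
      · rw [← sum_range_ite_lt (N := N)]
        · refine Finset.sum_congr rfl fun j _ => if_congr (by omega) rfl rfl
        · exact fun j hj => Finset.sum_eq_zero fun i _ => hv _ _ _ _ (Or.inr (by omega))
      · exact fun j i hj => hv _ _ _ _ (Or.inr (by omega))
      · intro j i
        rw [h34]
        congr 2 <;> push_cast <;> omega
  have reorder : diff24 P a b c d = ∑ l ∈ Finset.range N, ∑ i ∈ Finset.range N,
      ∑ j ∈ Finset.range N, S (a + i + j) (b + l) (c - i - l) (d - j) := by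
    rw [start, Finset.sum_congr rfl fun i _ => Finset.sum_comm, Finset.sum_comm]
  rw [reorder, Finset.sum_congr rfl key, Finset.sum_add_distrib]
  congr 1
  · refine sum_range_ite_lt fun l hl => Finset.sum_eq_zero fun i _ => Finset.sum_eq_zero fun j _ =>
      hv _ _ _ _ (Or.inl (by omega))
  · rw [Finset.sum_comm]
    refine Finset.sum_congr rfl fun j _ => ?_
    rw [← sum_range_eq_of_vanish (N := N) (M := j + f + 2 + N) _ (by omega), Finset.sum_range_add,
      Finset.sum_eq_zero, zero_add]
    · have key2 := sum_range_range_antisymm_tail (N := N) (s := f)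
        (g := fun i t : ℕ => S (a + i + j) (b + j + f + 2 + t) (c - i - j - f - 2 - t) (d - j)) ?_ ?_
      · rw [← key2, Finset.sum_comm]
        refine Finset.sum_congr rfl fun t _ => ?_
        rw [if_pos (by omega)]
        refine Finset.sum_congr rfl fun i _ => ?_
        congr 1 <;> push_cast <;> ring
      · exact fun i j hi => hv _ _ _ _ (Or.inl (by omega))
      · intro i t
        rw [h12]
        congr 2 <;> push_cast <;> omega
    · exact fun l hl => if_neg (by simp at hl; omega)
    · intro l hl
      rw [Finset.sum_eq_zero, ite_self]
      exact fun i _ => hv _ _ _ _ (Or.inl (by omega))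

end ShiftDifferences

section JacobiTrudi

variable {n : ℕ}

theorem hInt_of_neg {k : ℤ} (hk : k < 0) : hInt n k = 0 := if_neg (by omega)

theorem hInt_zero : hInt n 0 = 1 := by simp [hInt]

/-- The Jacobi-Trudi matrix of an integer sequence. -/
def jacobiTrudi (n : ℕ) {N : ℕ} (α : Fin N → ℤ) : Matrix (Fin N) (Fin N) (MvPolynomial (Fin n) ℚ) :=
  Matrix.of fun i j => hInt n (α i + j - i)

theorem jacobiTrudi_det_succ (μ : ℕ → ℕ) {N : ℕ} (h : μ N = 0) :
    (jacobiTrudi n fun i : Fin (N + 1) => (μ i : ℤ)).det =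
      (jacobiTrudi n fun i : Fin N => (μ i : ℤ)).det := by
  rw [Matrix.det_succ_row _ (Fin.last N), Fin.sum_univ_castSucc, Finset.sum_eq_zero, zero_add]
  · simp [jacobiTrudi, h, hInt_zero, ← two_mul, Matrix.submatrix]
  · intro j _
    have : hInt n (((0 : ℕ) : ℤ) + (j : ℕ) - N) = 0 := hInt_of_neg (by omega)
    simp [jacobiTrudi, h] at this ⊢
    simp [this]

theorem schur_eq_det {μ : ℕ → ℕ} {N : ℕ} (h : ∀ i, N ≤ i → μ i = 0) (hμ : Antitone μ) :
    schur n μ = (jacobiTrudi n fun i : Fin N => (μ i : ℤ)).det := by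
  have hp : μ (partLen μ) = 0 := Nat.sInf_mem (s := {N | μ N = 0}) ⟨N, h N le_rfl⟩
  have hle : partLen μ ≤ N := Nat.sInf_le (h N le_rfl)
  obtain ⟨m, rfl⟩ := Nat.exists_eq_add_of_le hle
  clear h hle
  induction m with
  | zero => rfl
  | succ m ih =>
    rw [ih]
    exact (jacobiTrudi_det_succ μ (Nat.eq_zero_of_le_zero ((hμ (by omega)).trans hp.le))).symm

theorem schurPositive_zero : SchurPositive n 0 := ⟨∅, 0, by simp, by simp, by simp⟩

theorem schurPositive_schur {μ : ℕ → ℕ} (h : IsPartition μ) : SchurPositive n (schur n μ) :=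
  ⟨{μ}, 1, by simpa, by simp, by simp⟩

theorem SchurPositive.smul {f : MvPolynomial (Fin n) ℚ} (hf : SchurPositive n f) {r : ℚ}
    (hr : 0 ≤ r) : SchurPositive n (r • f) := by
  obtain ⟨S, c, h1, h2, rfl⟩ := hf
  exact ⟨S, r • c, h1, fun μ hμ => mul_nonneg hr (h2 μ hμ), by simp [Finset.smul_sum, mul_smul]⟩

theorem SchurPositive.add {f g : MvPolynomial (Fin n) ℚ} (hf : SchurPositive n f)
    (hg : SchurPositive n g) : SchurPositive n (f + g) := by
  classical
  obtain ⟨S, c, h1, h2, rfl⟩ := hf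
  obtain ⟨T, d, h3, h4, rfl⟩ := hg
  refine ⟨S ∪ T, fun μ => (if μ ∈ S then c μ else 0) + if μ ∈ T then d μ else 0, ?_, ?_, ?_⟩
  · exact fun μ hμ => (Finset.mem_union.1 hμ).elim (h1 μ) (h3 μ)
  · intro μ _
    refine add_nonneg ?_ ?_ <;> split_ifs with h
    exacts [h2 μ h, le_rfl, h4 μ h, le_rfl]
  · simp only [add_smul, Finset.sum_add_distrib, ite_smul, zero_smul]
    congr 1
    · rw [← Finset.sum_filter, Finset.filter_mem_eq_inter,
        Finset.inter_eq_right.2 Finset.subset_union_left]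
    · rw [← Finset.sum_filter, Finset.filter_mem_eq_inter,
        Finset.inter_eq_right.2 Finset.subset_union_right]

theorem SchurPositive.sum {ι : Type*} {s : Finset ι} {f : ι → MvPolynomial (Fin n) ℚ}
    (h : ∀ i ∈ s, SchurPositive n (f i)) : SchurPositive n (∑ i ∈ s, f i) :=
  Finset.sum_induction _ _ (fun _ _ => SchurPositive.add) schurPositive_zero h

theorem jacobiTrudi_det_eq_zero_of_eq {N : ℕ} {α : Fin N → ℤ} {i j : Fin N} (hij : i ≠ j)
    (h : α i - i = α j - j) : (jacobiTrudi n α).det = 0 :=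
  Matrix.det_zero_of_row_eq hij (funext fun l => by
    simp only [jacobiTrudi, Matrix.of_apply]; congr 1; omega)

theorem jacobiTrudi_det_eq_zero_of_last_neg {N : ℕ} {α : Fin (N + 1) → ℤ}
    (h : α (Fin.last N) < 0) : (jacobiTrudi n α).det = 0 :=
  Matrix.det_eq_zero_of_row_eq_zero (Fin.last N) fun j => hInt_of_neg (by
    have := j.is_le; rw [Fin.val_last]; omega)

theorem schurPositive_jacobiTrudi_det {N : ℕ} {α : Fin (N + 1) → ℤ}
    (h : ∀ i : Fin N, α i.succ ≤ α i.castSucc + 1) : SchurPositive n (jacobiTrudi n α).det := by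
  by_cases h1 : ∃ i : Fin N, α i.succ = α i.castSucc + 1
  · obtain ⟨i, hi⟩ := h1
    rw [jacobiTrudi_det_eq_zero_of_eq (i := i.succ) (j := i.castSucc) (by simp [Fin.ext_iff])
      (by simp [hi])]
    exact schurPositive_zero
  by_cases h2 : α (Fin.last N) < 0
  · rw [jacobiTrudi_det_eq_zero_of_last_neg h2]
    exact schurPositive_zero
  have ha : Antitone α := Fin.antitone_iff_succ_le.2 fun i => by
    have := h i
    have h3 : α i.succ ≠ α i.castSucc + 1 := fun h => h1 ⟨i, h⟩
    omega
  have hnn : ∀ i, 0 ≤ α i := fun i => (not_lt.1 h2).trans (ha (Fin.le_last i))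
  set μ : ℕ → ℕ := fun i => if hi : i < N + 1 then (α ⟨i, hi⟩).toNat else 0 with hμ
  have hμ0 : ∀ i, N + 1 ≤ i → μ i = 0 := fun i hi => dif_neg (by omega)
  have hμa : Antitone μ := by
    intro i j hij
    by_cases hj : j < N + 1
    · simp only [hμ, dif_pos hj, dif_pos (hij.trans_lt hj)]
      exact Int.toNat_le_toNat (ha hij)
    · rw [hμ0 j (by omega)]
      exact Nat.zero_le _
  have : (fun i : Fin (N + 1) => (μ i : ℤ)) = α := by
    funext i
    simp only [hμ, dif_pos i.is_lt, Fin.eta, Int.toNat_of_nonneg (hnn i)]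
  rw [← this, ← schur_eq_det hμ0 hμa]
  exact schurPositive_schur ⟨hμa, N + 1, hμ0⟩

theorem sum_det_updateRow {R : Type*} [CommRing R] {N : ℕ} (M M' : Matrix (Fin (N + 1)) (Fin (N + 1)) R)
    (h : ∀ i (j : Fin N), M' i j.castSucc = M i j.succ) :
    ∑ i, (M.updateRow i (M' i)).det =
      (M.updateCol (Fin.last N) fun i => M' i (Fin.last N)).det := by
  have h1 : ∀ i, (M.updateRow i (M' i)).det = ∑ j, M.adjugate j i * M' i j := fun i => by
    rw [← Matrix.cramer_transpose_apply, Matrix.cramer_eq_adjugate_mulVec,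
      ← Matrix.adjugate_transpose]
    rfl
  have h2 : ∀ j, (M.updateCol j fun i => M' i j).det = ∑ i, M.adjugate j i * M' i j := fun j => by
    rw [← Matrix.cramer_apply, Matrix.cramer_eq_adjugate_mulVec]
    rfl
  simp only [h1]
  rw [Finset.sum_comm, h2, Fin.sum_univ_castSucc, add_eq_right]
  refine Finset.sum_eq_zero fun j _ => ?_
  rw [← h2]
  refine Matrix.det_zero_of_column_eq (i := j.castSucc) (j := j.succ) (by simp [Fin.ext_iff]) ?_
  intro i
  rw [Matrix.updateCol_self, Matrix.updateCol_ne (by simp [Fin.ext_iff]), h]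

theorem hInt_one_mul_jacobiTrudi_det {N : ℕ} (α : Fin (N + 1) → ℤ) :
    hInt n 1 * (jacobiTrudi n α).det =
      ∑ i, (jacobiTrudi n (Function.update α i (α i + 1))).det +
        (jacobiTrudi n (Fin.snoc α 1 : Fin (N + 2) → ℤ)).det := by
  have hM := sum_det_updateRow (jacobiTrudi n α) (Matrix.of fun i j => hInt n (α i + 1 + j - i))
    (fun i j => by simp only [jacobiTrudi, Matrix.of_apply, Fin.val_castSucc, Fin.val_succ]
                   congr 1; push_cast; ring)
  have hrow : ∀ i, jacobiTrudi n (Function.update α i (α i + 1)) = (jacobiTrudi n α).updateRow i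
      (Matrix.of (fun i j : Fin (N + 1) => hInt n (α i + 1 + j - i)) i) := fun i => by
    ext1 i' j
    rcases eq_or_ne i' i with rfl | hi
    · simp [jacobiTrudi]
    · simp [jacobiTrudi, hi]
  simp only [hrow, hM]
  rw [Matrix.det_succ_row (jacobiTrudi n (Fin.snoc α 1 : Fin (N + 2) → ℤ)) (Fin.last (N + 1)),
    Fin.sum_univ_castSucc, Fin.sum_univ_castSucc, Finset.sum_eq_zero]
  · have e1 : (jacobiTrudi n (Fin.snoc α 1 : Fin (N + 2) → ℤ)).submatrix (Fin.last (N + 1)).succAbove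
        (Fin.last (N + 1)).succAbove = jacobiTrudi n α := by
      ext1 i j
      simp [jacobiTrudi]
    have e2 : (jacobiTrudi n (Fin.snoc α 1 : Fin (N + 2) → ℤ)).submatrix (Fin.last (N + 1)).succAbove
        (Fin.last N).castSucc.succAbove = (jacobiTrudi n α).updateCol (Fin.last N)
          fun i => Matrix.of (fun i j : Fin (N + 1) => hInt n (α i + 1 + j - i)) i (Fin.last N) := by
      ext1 i j
      induction j using Fin.lastCases with
      | last =>
        simp only [jacobiTrudi, Matrix.submatrix_apply, Matrix.of_apply, Fin.succAbove_last,
          Fin.snoc_castSucc, Matrix.updateCol_self, Fin.succAbove_castSucc_self, Fin.val_succ,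
          Fin.val_castSucc, Fin.val_last]
        congr 1; push_cast; ring
      | cast j =>
        rw [Matrix.updateCol_ne (Fin.castSucc_lt_last j).ne]
        simp only [jacobiTrudi, Matrix.submatrix_apply, Matrix.of_apply, Fin.succAbove_last,
          Fin.snoc_castSucc, Fin.val_castSucc]
        rw [Fin.succAbove_of_castSucc_lt _ _ (by simp [Fin.lt_def])]
        simp
    rw [e1, e2]
    simp only [jacobiTrudi, Matrix.of_apply, Fin.snoc_last, Fin.val_last, Fin.val_castSucc]
    rw [show (1 : ℤ) + (N : ℕ) - ((N + 1 : ℕ) : ℤ) = 0 by push_cast; ring, hInt_zero,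
      show (1 : ℤ) + (N + 1 : ℕ) - ((N + 1 : ℕ) : ℤ) = 1 by push_cast; ring,
      show N + 1 + N = 2 * N + 1 by ring, ← two_mul (N + 1)]
    simp [pow_succ, pow_mul]
  · intro j _
    simp only [jacobiTrudi, Matrix.of_apply, Fin.snoc_last, Fin.val_last, Fin.val_castSucc]
    rw [hInt_of_neg (by have := j.is_lt; push_cast; omega)]
    simp

theorem schurPositive_hInt_one_mul {N : ℕ} {α : Fin (N + 1) → ℤ}
    (h : ∀ i : Fin N, α i.succ ≤ α i.castSucc) (h0 : 0 ≤ α (Fin.last N)) :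
    SchurPositive n (hInt n 1 * (jacobiTrudi n α).det) := by
  rw [hInt_one_mul_jacobiTrudi_det]
  refine (SchurPositive.sum fun i _ => schurPositive_jacobiTrudi_det fun j => ?_).add
    (schurPositive_jacobiTrudi_det fun j => ?_)
  · have := h j
    rcases eq_or_ne j.succ i with rfl | h1
    · rw [Function.update_self, Function.update_of_ne (by simp [Fin.ext_iff])]; omega
    · rw [Function.update_of_ne h1]
      rcases eq_or_ne j.castSucc i with rfl | h2
      · rw [Function.update_self]; omega
      · rw [Function.update_of_ne h2]; omega
  · induction j using Fin.lastCases with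
    | last => simpa using h0
    | cast j =>
      rw [Fin.succ_castSucc, Fin.snoc_castSucc, Fin.snoc_castSucc]
      have := h j
      omega

end JacobiTrudi

section FourRows

variable {R : Type*} [CommRing R]

/-- The operator sending a product of two-row determinants to one of hook rows. -/
def opX (r : R) (f : ℤ → ℤ → ℤ → ℤ → R) (a b c d : ℤ) : R :=
  r ^ 2 * f a b c d -
    r * (f (a + 1) b c d + f a (b + 1) c d + f a b (c + 1) d + f a b c (d + 1)) +
    (f (a + 1) b (c + 1) d + f (a + 1) b c (d + 1) + f a (b + 1) (c + 1) d + f a (b + 1) c (d + 1))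

/-- The operator turning the first two-row factor of a product into a hook row. -/
def opZ (r : R) (f : ℤ → ℤ → ℤ → ℤ → R) (a b c d : ℤ) : R :=
  r * f a b c d - f (a + 1) b c d - f a (b + 1) c d

theorem crossDiff_opX (r : R) (f : ℤ → ℤ → ℤ → ℤ → R) :
    crossDiff (opX r f) = opX r (crossDiff f) := by
  funext a b c d
  simp only [crossDiff, diff13, diff14, diff23, diff24, opX]
  ring_nf

theorem crossDiff_opZ (r : R) (f : ℤ → ℤ → ℤ → ℤ → R) :
    crossDiff (opZ r f) = opZ r (crossDiff f) := by
  funext a b c d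
  simp only [crossDiff, diff13, diff14, diff23, diff24, opZ]
  ring_nf

def Antisymm12 (f : ℤ → ℤ → ℤ → ℤ → R) : Prop := ∀ a b c d, f a b c d = -f (b - 1) (a + 1) c d

def Antisymm34 (f : ℤ → ℤ → ℤ → ℤ → R) : Prop := ∀ a b c d, f a b c d = -f a b (d - 1) (c + 1)

theorem Antisymm12.opX {f : ℤ → ℤ → ℤ → ℤ → R} (hf : Antisymm12 f) (r : R) :
    Antisymm12 (opX r f) := fun a b c d => by
  simp only [_root_.opX]
  rw [hf a b c d, hf (a + 1) b c d, hf a (b + 1) c d, hf a b (c + 1) d, hf a b c (d + 1),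
    hf (a + 1) b (c + 1) d, hf (a + 1) b c (d + 1), hf a (b + 1) (c + 1) d, hf a (b + 1) c (d + 1)]
  ring_nf

theorem Antisymm34.opX {f : ℤ → ℤ → ℤ → ℤ → R} (hf : Antisymm34 f) (r : R) :
    Antisymm34 (opX r f) := fun a b c d => by
  simp only [_root_.opX]
  rw [hf a b c d, hf (a + 1) b c d, hf a (b + 1) c d, hf a b (c + 1) d, hf a b c (d + 1),
    hf (a + 1) b (c + 1) d, hf (a + 1) b c (d + 1), hf a (b + 1) (c + 1) d, hf a (b + 1) c (d + 1)]
  ring_nf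

theorem Antisymm12.opZ {f : ℤ → ℤ → ℤ → ℤ → R} (hf : Antisymm12 f) (r : R) :
    Antisymm12 (opZ r f) := fun a b c d => by
  simp only [_root_.opZ]
  rw [hf a b c d, hf (a + 1) b c d, hf a (b + 1) c d]
  ring_nf

theorem Antisymm34.opZ {f : ℤ → ℤ → ℤ → ℤ → R} (hf : Antisymm34 f) (r : R) :
    Antisymm34 (opZ r f) := fun a b c d => by
  simp only [_root_.opZ]
  rw [hf a b c d, hf (a + 1) b c d, hf a (b + 1) c d]
  ring_nf

/-- The two-row Jacobi-Trudi determinant of the sequence `h`. -/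
def twoRow (h : ℤ → R) (a b : ℤ) : R := h a * h b - h (a + 1) * h (b - 1)

/-- The four-row Jacobi-Trudi determinant, as a cross difference of two-row products. -/
def fourRow (h : ℤ → R) : ℤ → ℤ → ℤ → ℤ → R :=
  crossDiff fun a b c d => twoRow h a b * twoRow h c d

/-- The Jacobi-Trudi determinant of shape `(a, b, 1)` of the sequence `h`. -/
def hookRow (h : ℤ → R) (a b : ℤ) : R :=
  h 1 * twoRow h a b - twoRow h (a + 1) b - twoRow h a (b + 1)

theorem fourRow_eq_det (h : ℤ → R) (a b c d : ℤ) :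
    fourRow h a b c d =
      (Matrix.of fun i j : Fin 4 => h ((![a, b, c, d] : Fin 4 → ℤ) i + j - i)).det := by
  simp [fourRow, crossDiff, diff13, diff14, diff23, diff24, twoRow, Matrix.det_succ_row_zero,
    Fin.sum_univ_succ, Fin.succAbove]
  ring_nf
theorem fourRow_antisymm12 (h : ℤ → R) : Antisymm12 (fourRow h) := fun a b c d => by
  simp only [fourRow, crossDiff, diff13, diff14, diff23, diff24, twoRow]
  ring_nf
theorem fourRow_antisymm34 (h : ℤ → R) : Antisymm34 (fourRow h) := fun a b c d => by
  simp only [fourRow, crossDiff, diff13, diff14, diff23, diff24, twoRow]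
  ring_nf
theorem fourRow_antisymm23 (h : ℤ → R) (a b c d : ℤ) :
    fourRow h a b c d = -fourRow h a (c - 1) (b + 1) d := by
  simp only [fourRow, crossDiff, diff13, diff14, diff23, diff24, twoRow]
  ring_nf

end FourRows

section FourRowSchur

variable {n : ℕ}

/-- The Schur polynomial of a sequence of four integers. -/
def fourSchur (n : ℕ) : ℤ → ℤ → ℤ → ℤ → MvPolynomial (Fin n) ℚ := fourRow (hInt n)

/-- The Schur polynomial of the sequence `(a, b, c, d, 1)`. -/
def fiveSchur (n : ℕ) (a b c d : ℤ) : MvPolynomial (Fin n) ℚ :=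
  (jacobiTrudi n ![a, b, c, d, 1]).det

theorem fourSchur_eq_det (a b c d : ℤ) :
    fourSchur n a b c d = (jacobiTrudi n ![a, b, c, d]).det := fourRow_eq_det _ _ _ _ _

theorem schurPositive_fourSchur {a b c d : ℤ} (h1 : b ≤ a + 1) (h2 : c ≤ b + 1) (h3 : d ≤ c + 1) :
    SchurPositive n (fourSchur n a b c d) := by
  rw [fourSchur_eq_det]
  refine schurPositive_jacobiTrudi_det fun i => ?_
  fin_cases i
  exacts [h1, h2, h3]

theorem schurPositive_fiveSchur {a b c d : ℤ} (h1 : b ≤ a + 1) (h2 : c ≤ b + 1) (h3 : d ≤ c + 1)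
    (h4 : 0 ≤ d) : SchurPositive n (fiveSchur n a b c d) := by
  refine schurPositive_jacobiTrudi_det fun i => ?_
  fin_cases i
  exacts [h1, h2, h3, by simpa using h4]

theorem schurPositive_hInt_one_mul_fiveSchur {a b c d : ℤ} (h1 : b ≤ a) (h2 : c ≤ b) (h3 : d ≤ c)
    (h4 : 1 ≤ d) : SchurPositive n (hInt n 1 * fiveSchur n a b c d) := by
  refine schurPositive_hInt_one_mul (fun i => ?_) ?_
  · fin_cases i
    exacts [h1, h2, h3, h4]
  · exact zero_le_one

theorem fourSchur_of_neg {a b c d : ℤ} (h : d < 0) : fourSchur n a b c d = 0 := by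
  rw [fourSchur_eq_det]
  exact jacobiTrudi_det_eq_zero_of_last_neg h

theorem fourSchur_eq_zero23 {a b c d : ℤ} (h : c = b + 1) : fourSchur n a b c d = 0 := by
  rw [fourSchur_eq_det]
  exact jacobiTrudi_det_eq_zero_of_eq (i := 1) (j := 2) (by decide) (by simp [h]; ring)

theorem fiveSchur_zero (a b c : ℤ) : fiveSchur n a b c 0 = 0 :=
  jacobiTrudi_det_eq_zero_of_eq (i := 3) (j := 4) (by decide) (by simp)

theorem hInt_one_mul_fourSchur (a b c d : ℤ) :
    hInt n 1 * fourSchur n a b c d = fourSchur n (a + 1) b c d + fourSchur n a (b + 1) c d +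
      fourSchur n a b (c + 1) d + fourSchur n a b c (d + 1) + fiveSchur n a b c d := by
  have e0 : Function.update ![a, b, c, d] 0 (a + 1) = ![a + 1, b, c, d] := by
    ext i; fin_cases i <;> rfl
  have e1 : Function.update ![a, b, c, d] 1 (b + 1) = ![a, b + 1, c, d] := by
    ext i; fin_cases i <;> rfl
  have e2 : Function.update ![a, b, c, d] 2 (c + 1) = ![a, b, c + 1, d] := by
    ext i; fin_cases i <;> rfl
  have e3 : Function.update ![a, b, c, d] 3 (d + 1) = ![a, b, c, d + 1] := by
    ext i; fin_cases i <;> rfl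
  have e4 : (Fin.snoc ![a, b, c, d] 1 : Fin 5 → ℤ) = ![a, b, c, d, 1] := by
    ext i; fin_cases i <;> rfl
  have h := hInt_one_mul_jacobiTrudi_det (n := n) ![a, b, c, d]
  rw [Fin.sum_univ_four, e4] at h
  simp only [fourSchur_eq_det, fiveSchur, ← e0, ← e1, ← e2, ← e3]
  exact h

theorem opX_fourSchur (a b c d : ℤ) :
    opX (hInt n 1) (fourSchur n) a b c d = hInt n 1 * fiveSchur n a b c d +
      (fourSchur n (a + 1) b (c + 1) d + fourSchur n (a + 1) b c (d + 1) +
        fourSchur n a (b + 1) (c + 1) d + fourSchur n a (b + 1) c (d + 1)) := by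
  rw [opX]
  linear_combination hInt n 1 * hInt_one_mul_fourSchur (n := n) a b c d

theorem opZ_fourSchur (a b c d : ℤ) :
    opZ (hInt n 1) (fourSchur n) a b c d =
      fourSchur n a b (c + 1) d + fourSchur n a b c (d + 1) + fiveSchur n a b c d := by
  rw [opZ]
  linear_combination hInt_one_mul_fourSchur (n := n) a b c d

theorem opZ_fourSchur_of_neg {a b c d : ℤ} (h : d < 0) :
    opZ (hInt n 1) (fourSchur n) a b c d = 0 := by
  simp [opZ, fourSchur_of_neg h]

theorem opX_fourSchur_of_lt {a b c d : ℤ} (h : d < -1) :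
    opX (hInt n 1) (fourSchur n) a b c d = 0 := by
  simp [opX, fourSchur_of_neg (show d < 0 by omega), fourSchur_of_neg (show d + 1 < 0 by omega)]

theorem opX_fourSchur_neg_one {a b c d : ℤ} (h : d = -1) :
    opX (hInt n 1) (fourSchur n) a b c d =
      -(fourSchur n a b (c + 1) 0 + fourSchur n a b c 1) := by
  have := hInt_one_mul_fourSchur (n := n) a b c 0
  rw [fiveSchur_zero, zero_add] at this
  subst h
  simp only [opX, fourSchur_of_neg (show (-1 : ℤ) < 0 by omega), show (-1 : ℤ) + 1 = 0 by rfl]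
  linear_combination -this

theorem opX_fourSchur_neg_one_neg_one {a b c d : ℤ} (hc : c = -1) (hd : d = -1) :
    opX (hInt n 1) (fourSchur n) a b c d = 0 := by
  have := fourRow_antisymm34 (hInt n) a b (-1) 1
  rw [opX_fourSchur_neg_one hd, hc]
  simp only [fourSchur]
  rw [this]
  simp

theorem opX_fourSchur_zero (a b c : ℤ) :
    opX (hInt n 1) (fourSchur n) a b c 0 = fourSchur n (a + 1) b (c + 1) 0 +
      fourSchur n (a + 1) b c 1 + fourSchur n a (b + 1) (c + 1) 0 + fourSchur n a (b + 1) c 1 := by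
  rw [opX_fourSchur, fiveSchur_zero]; ring_nf

theorem opX_fourSchur_line {a b c d : ℤ} (h : c = b + 1) :
    opX (hInt n 1) (fourSchur n) a b c d =
      fourSchur n a c c (d + 1) - fourSchur n (a + 1) c c d := by
  have h1 : ∀ a d, fourSchur n a b (c + 1) d = - fourSchur n a c c d := fun a d => by
    rw [fourSchur, fourRow_antisymm23]; subst h; ring_nf
  rw [opX, h1, h1]
  simp only [fourSchur_eq_zero23 h, ← h, fourSchur_eq_zero23 (rfl : c + 1 = c + 1)]
  ring

theorem opZ_fourSchur_line {a b c d : ℤ} (h : c = b + 1) :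
    opZ (hInt n 1) (fourSchur n) a b c d = -fourSchur n a c c d := by
  simp [opZ, ← h, fourSchur_eq_zero23 h]

theorem schurPositive_opZ_fourSchur {a b c d : ℤ} (h1 : b ≤ a) (h2 : c ≤ b) (h3 : d ≤ c) :
    SchurPositive n (opZ (hInt n 1) (fourSchur n) a b c d - fourSchur n a b (c + 1) d) := by
  rcases lt_or_ge d 0 with hd | hd
  · rw [opZ_fourSchur_of_neg hd, fourSchur_of_neg hd, sub_zero]
    exact schurPositive_zero
  · rw [opZ_fourSchur, add_assoc, add_sub_cancel_left]
    exact (schurPositive_fourSchur (by omega) (by omega) (by omega)).add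
      (schurPositive_fiveSchur (by omega) (by omega) (by omega) hd)

theorem schurPositive_sum_opX_sub {a b c : ℤ} {d : ℕ} (h1 : b ≤ a) (h2 : c ≤ b) (h3 : (d : ℤ) ≤ c)
    {N : ℕ} (hN : d + 2 ≤ N) {e : ℤ} (he : e = d) :
    SchurPositive n (∑ j ∈ Finset.range N, opX (hInt n 1) (fourSchur n) (a + j) b c (e - j) -
      ∑ j ∈ Finset.range N, fourSchur n (a + j) (b + 1) (c + 1) (e - j)) := by
  subst he
  rw [← Finset.sum_sub_distrib, sum_range_eq_of_vanish _ hN, Finset.sum_range_succ,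
    Finset.sum_range_succ, add_assoc]
  · refine (SchurPositive.sum fun j hj => ?_).add ?_
    · have := Finset.mem_range.1 hj
      have hx := opX_fourSchur (n := n) (a + j) b c (d - j)
      rw [hx, show ∀ x y z u v : MvPolynomial (Fin n) ℚ, x + (y + z + u + v) - u = x + y + z + v by
        intros; ring]
      refine SchurPositive.add (SchurPositive.add (SchurPositive.add
        (schurPositive_hInt_one_mul_fiveSchur ?_ ?_ ?_ ?_) ?_) ?_) ?_
      any_goals refine schurPositive_fourSchur ?_ ?_ ?_
      all_goals omega
    · rw [opX_fourSchur_neg_one (d := (d : ℤ) - ((d + 1 : ℕ) : ℤ)) (by push_cast; ring), sub_self,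
        opX_fourSchur_zero, fourSchur_of_neg (d := (d : ℤ) - ((d + 1 : ℕ) : ℤ)) (by push_cast; omega)]
      push_cast
      rw [← add_assoc]
      ring_nf
      exact schurPositive_fourSchur (by omega) (by omega) (by omega)
  · intro j hj
    rw [opX_fourSchur_of_lt (by omega), fourSchur_of_neg (by omega), sub_zero]

theorem schurPositive_sum_opX {a b c : ℤ} {d : ℕ} (h1 : b ≤ a) (h2 : c ≤ b) (h3 : (d : ℤ) ≤ c)
    {N : ℕ} (hN : d + 2 ≤ N) {e : ℤ} (he : e = d) :
    SchurPositive n (∑ j ∈ Finset.range N, opX (hInt n 1) (fourSchur n) (a + j) b c (e - j)) := by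
  rw [← sub_add_cancel (∑ j ∈ Finset.range N, opX (hInt n 1) (fourSchur n) (a + j) b c (e - j))
    (∑ j ∈ Finset.range N, fourSchur n (a + j) (b + 1) (c + 1) (e - j))]
  exact (schurPositive_sum_opX_sub h1 h2 h3 hN he).add (SchurPositive.sum fun j _ =>
    schurPositive_fourSchur (by omega) (by omega) (by omega))

end FourRowSchur

section Products

variable {n : ℕ}

/-- The product of two two-row determinants. -/
def twoRowProd (n : ℕ) (a b c d : ℤ) : MvPolynomial (Fin n) ℚ :=
  twoRow (hInt n) a b * twoRow (hInt n) c d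

theorem crossDiff_twoRowProd : crossDiff (twoRowProd n) = fourSchur n := rfl

theorem fourSchur_antisymm12 : Antisymm12 (fourSchur n) := fourRow_antisymm12 _

theorem fourSchur_antisymm34 : Antisymm34 (fourSchur n) := fourRow_antisymm34 _

theorem antisymm12_crossDiff_opX :
    Antisymm12 (crossDiff (opX (hInt n 1) (twoRowProd n))) := by
  rw [crossDiff_opX, crossDiff_twoRowProd]
  exact fourSchur_antisymm12.opX _

theorem antisymm34_crossDiff_opX :
    Antisymm34 (crossDiff (opX (hInt n 1) (twoRowProd n))) := by
  rw [crossDiff_opX, crossDiff_twoRowProd]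
  exact fourSchur_antisymm34.opX _

theorem antisymm12_crossDiff_opZ :
    Antisymm12 (crossDiff (opZ (hInt n 1) (twoRowProd n))) := by
  rw [crossDiff_opZ, crossDiff_twoRowProd]
  exact fourSchur_antisymm12.opZ _

theorem antisymm34_crossDiff_opZ :
    Antisymm34 (crossDiff (opZ (hInt n 1) (twoRowProd n))) := by
  rw [crossDiff_opZ, crossDiff_twoRowProd]
  exact fourSchur_antisymm34.opZ _

theorem antisymm12_crossDiff_twoRowProd : Antisymm12 (crossDiff (twoRowProd n)) := by
  rw [crossDiff_twoRowProd]
  exact fourSchur_antisymm12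

theorem antisymm34_crossDiff_twoRowProd : Antisymm34 (crossDiff (twoRowProd n)) := by
  rw [crossDiff_twoRowProd]
  exact fourSchur_antisymm34

attribute [irreducible] fourSchur opX opZ crossDiff

theorem twoRow_eq_zero {k b : ℤ} (h : b = k + 1) : twoRow (hInt n) k b = 0 := by
  subst h
  rw [twoRow, add_sub_cancel_right]; ring

theorem vanishesBelow_twoRowProd : VanishesBelow (-1) (twoRowProd n) := by
  intro a b c d h
  have h2 : twoRow (hInt n) c d = 0 := by
    rw [twoRow]
    rcases h with h | h
    · rw [hInt_of_neg (k := c) (by omega), hInt_of_neg (k := c + 1) (by omega)]; ring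
    · rw [hInt_of_neg (k := d) (by omega), hInt_of_neg (k := d - 1) (by omega)]; ring
  rw [twoRowProd, h2, mul_zero]

theorem VanishesBelow.opX {R : Type*} [CommRing R] {B : ℤ} {f : ℤ → ℤ → ℤ → ℤ → R}
    (hf : VanishesBelow B f) (r : R) : VanishesBelow (B - 1) (opX r f) := fun a b c d h => by
  simp only [_root_.opX]
  rw [hf a b c d (by omega), hf (a + 1) b c d (by omega), hf a (b + 1) c d (by omega),
    hf a b (c + 1) d (by omega), hf a b c (d + 1) (by omega), hf (a + 1) b (c + 1) d (by omega),
    hf (a + 1) b c (d + 1) (by omega), hf a (b + 1) (c + 1) d (by omega),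
    hf a (b + 1) c (d + 1) (by omega)]
  ring

theorem VanishesBelow.opZ {R : Type*} [CommRing R] {B : ℤ} {f : ℤ → ℤ → ℤ → ℤ → R}
    (hf : VanishesBelow B f) (r : R) : VanishesBelow B (opZ r f) := fun a b c d h => by
  simp only [_root_.opZ]
  rw [hf a b c d h, hf (a + 1) b c d h, hf a (b + 1) c d h]
  ring

theorem opX_twoRowProd (a b c d : ℤ) :
    opX (hInt n 1) (twoRowProd n) a b c d = hookRow (hInt n) a b * hookRow (hInt n) c d := by
  simp only [opX, twoRowProd, hookRow]; ring

theorem opZ_twoRowProd (a b c d : ℤ) :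
    opZ (hInt n 1) (twoRowProd n) a b c d = hookRow (hInt n) a b * twoRow (hInt n) c d := by
  simp only [opZ, twoRowProd, hookRow]; ring

/-- The Schur expansion shared by the quadratic differences of hook rows. -/
def commonPart (n k : ℕ) : MvPolynomial (Fin n) ℚ :=
  ∑ j ∈ Finset.range (k + 3), fourSchur n (k + j) k k (k - j)

theorem commonPart_eq (n k : ℕ) : commonPart n k = fourSchur n k k k k +
    ∑ j ∈ Finset.range (k + 3), fourSchur n (k + 1 + j) k k (k - 1 - j) := by
  have h := Finset.sum_range_succ' (fun j : ℕ => fourSchur n (k + j) k k (k - j)) (k + 3)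
  rw [Finset.sum_range_succ, fourSchur_of_neg (by push_cast; omega), add_zero] at h
  rw [commonPart, h, add_comm]
  congr 1
  refine Finset.sum_congr rfl fun j _ => ?_
  push_cast; ring_nf

theorem schurPositive_commonPart (n k : ℕ) : SchurPositive n (commonPart n k) :=
  SchurPositive.sum fun j _ => schurPositive_fourSchur (by omega) (by omega) (by omega)

theorem sum_opX_line (n k : ℕ) :
    ∑ j ∈ Finset.range (k + 3), opX (hInt n 1) (fourSchur n) (k + j) (k - 1) k (k - 1 - j) =
      commonPart n k -
        ∑ j ∈ Finset.range (k + 3), fourSchur n (k + 1 + j) k k (k - 1 - j) := by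
  rw [commonPart, ← Finset.sum_sub_distrib]
  refine Finset.sum_congr rfl fun j _ => ?_
  rw [opX_fourSchur_line (by ring)]
  ring_nf

theorem schurPositive_sum_opX_lines (n k : ℕ) (hk : 1 ≤ k) : SchurPositive n
    (∑ j ∈ Finset.range (k + 3), opX (hInt n 1) (fourSchur n) (k + j) (k - 1) k (k - 1 - j) +
      ∑ j ∈ Finset.range (k + 3),
        opX (hInt n 1) (fourSchur n) (k + 1 + j) (k - 1) (k - 1) (k - 1 - j) - commonPart n k) := by
  have h := schurPositive_sum_opX_sub (n := n) (a := k + 1) (b := k - 1) (c := k - 1) (d := k - 1)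
    (N := k + 3) (e := k - 1) (by omega) le_rfl (by omega) (by omega) (by omega)
  rw [sub_add_cancel] at h
  rw [sum_opX_line]
  convert h using 1
  ring

theorem schurPositive_twoRow_sq_sub (n k : ℕ) :
    SchurPositive n (twoRow (hInt n) k k ^ 2 - commonPart n k) := by
  have h := diff23_eq_sum (vanishesBelow_twoRowProd (n := n)) antisymm12_crossDiff_twoRowProd
    antisymm34_crossDiff_twoRowProd (a := k) (b := k) (c := k) (d := k) (e := 0) (f := 0) (N := k + 3)
    (by simp) (by simp) (by push_cast; omega)
  rw [crossDiff_twoRowProd, diff23, twoRowProd, twoRowProd,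
    twoRow_eq_zero (k := k - 1) (by ring), mul_zero, sub_zero, ← sq] at h
  rw [h, Finset.sum_range_succ']
  simp only [zero_add, add_zero, Finset.sum_range_one, Nat.cast_zero, sub_zero, le_refl, if_true]
  rw [commonPart, add_sub_cancel_right]
  refine SchurPositive.sum fun l _ => SchurPositive.sum fun i hi => ?_
  split_ifs
  · refine SchurPositive.sum fun j _ => ?_
    have := Finset.mem_range.1 hi
    apply schurPositive_fourSchur <;> push_cast <;> omega
  · exact schurPositive_zero

theorem hookRow_mul_twoRow_sub (n k : ℕ) :
    hookRow (hInt n) k k * twoRow (hInt n) k (k - 1) -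
      hookRow (hInt n) k (k - 1) * twoRow (hInt n) k k = commonPart n k := by
  have h := diff24_eq_sum (vanishesBelow_twoRowProd.opZ (hInt n 1))
    antisymm12_crossDiff_opZ antisymm34_crossDiff_opZ
    (a := k) (b := k - 1) (c := k) (d := k) (f := 0) (N := k + 3)
    (by simp) (by simp) (by push_cast; omega)
  rw [crossDiff_opZ, crossDiff_twoRowProd, diff24, opZ_twoRowProd, opZ_twoRowProd] at h
  simp [opZ_fourSchur_line (c := (k : ℤ)) (show (k : ℤ) = k - 1 + 1 by ring)] at h
  rw [commonPart, ← neg_sub, h, neg_neg]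

theorem schurPositive_hookRow_mul_twoRow (n k : ℕ) (hk : 1 ≤ k) :
    SchurPositive n (hookRow (hInt n) k (k - 1) * twoRow (hInt n) k k) := by
  have h := diff23_eq_sum (vanishesBelow_twoRowProd.opZ (hInt n 1))
    antisymm12_crossDiff_opZ antisymm34_crossDiff_opZ
    (a := k) (b := k - 1) (c := k) (d := k) (e := 1) (f := 0) (N := k + 3)
    (by simp) (by simp) (by push_cast; omega)
  rw [crossDiff_opZ, crossDiff_twoRowProd, diff23, opZ_twoRowProd, opZ_twoRowProd,
    twoRow_eq_zero (k := k - 1) (by ring), mul_zero, sub_zero] at h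
  have hZ : ∀ a b c d : ℤ, b ≤ a → c ≤ b → d ≤ c →
      SchurPositive n (opZ (hInt n 1) (fourSchur n) a b c d) := fun a b c d h1 h2 h3 => by
    rw [← sub_add_cancel (opZ (hInt n 1) (fourSchur n) a b c d) (fourSchur n a b (c + 1) d)]
    exact (schurPositive_opZ_fourSchur h1 h2 h3).add
      (schurPositive_fourSchur (by omega) (by omega) (by omega))
  rw [h, show k + 3 = k + 1 + 1 + 1 by ring, Finset.sum_range_succ', Finset.sum_range_succ',
    add_assoc]
  refine SchurPositive.add (SchurPositive.sum fun l _ => SchurPositive.sum fun i hi => ?_) ?_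
  · split_ifs
    · refine SchurPositive.sum fun j _ => ?_
      have := Finset.mem_range.1 hi
      apply hZ <;> push_cast <;> omega
    · exact schurPositive_zero
  · have e0 : ∑ j ∈ Finset.range (k + 3), opZ (hInt n 1) (fourSchur n) (k + j) (k - 1) k (k - j) =
        -commonPart n k := by
      rw [commonPart, ← Finset.sum_neg_distrib]
      exact Finset.sum_congr rfl fun j _ => opZ_fourSchur_line (by ring)
    have e1 : SchurPositive n (∑ j ∈ Finset.range (k + 3),
        opZ (hInt n 1) (fourSchur n) (k + j) k k (k - j - 1) - fourSchur n k k k k) := by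
      rw [Finset.sum_range_succ', Nat.cast_zero, add_zero, sub_zero, add_sub_assoc, opZ_fourSchur,
        sub_add_cancel, add_right_comm, add_sub_cancel_right]
      refine (SchurPositive.sum fun j _ => hZ _ _ _ _ ?_ ?_ ?_).add
        ((schurPositive_fourSchur ?_ ?_ ?_).add (schurPositive_fiveSchur ?_ ?_ ?_ ?_))
      all_goals omega
    have e2 : SchurPositive n (∑ j ∈ Finset.range (k + 3),
        opZ (hInt n 1) (fourSchur n) (k + 1 + j) k (k - 1) (k - j - 1) -
        ∑ j ∈ Finset.range (k + 3), fourSchur n (k + 1 + j) k k (k - 1 - j)) := by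
      rw [← Finset.sum_sub_distrib]
      refine SchurPositive.sum fun j _ => ?_
      rw [sub_right_comm (k : ℤ) 1 j]
      have := schurPositive_opZ_fourSchur (n := n) (a := k + 1 + j) (b := k) (c := k - 1)
        (d := k - j - 1) (by omega) (by omega) (by omega)
      rwa [sub_add_cancel] at this
    have e := e1.add e2
    simp [Finset.sum_range_succ _ 1]
    convert e using 1
    rw [e0, commonPart_eq]
    ring

def opXCol (n N : ℕ) (a b c d : ℤ) : MvPolynomial (Fin n) ℚ :=
  ∑ j ∈ Finset.range N, opX (hInt n 1) (fourSchur n) (a + j) b c (d - j)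

theorem opXCol_of_lt {N : ℕ} {a b c d : ℤ} (h : d < -1) : opXCol n N a b c d = 0 :=
  Finset.sum_eq_zero fun j _ => opX_fourSchur_of_lt (by omega)

theorem opXCol_neg_one (N : ℕ) (a b c : ℤ) :
    opXCol n (N + 1) a b c (-1) = -(fourSchur n a b (c + 1) 0 + fourSchur n a b c 1) := by
  rw [opXCol, Finset.sum_range_succ', Finset.sum_eq_zero, zero_add,
    opX_fourSchur_neg_one (by simp), Nat.cast_zero, add_zero]
  exact fun j _ => opX_fourSchur_of_lt (by push_cast; omega)

theorem opXCol_neg_one_neg_one (N : ℕ) (a b : ℤ) : opXCol n N a b (-1) (-1) = 0 := by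
  refine Finset.sum_eq_zero fun j _ => ?_
  rcases Nat.eq_zero_or_pos j with rfl | hj
  · exact opX_fourSchur_neg_one_neg_one rfl (by simp)
  · exact opX_fourSchur_of_lt (by omega)

theorem opXCol_zero_add_opXCol_neg_one (N : ℕ) (a b c : ℤ) :
    opXCol n (N + 2) a b c 0 + opXCol n (N + 2) a (b + 1) c (-1) = 0 := by
  rw [opXCol_neg_one, opXCol, Finset.sum_range_succ', Finset.sum_range_succ', Finset.sum_eq_zero,
    zero_add, opX_fourSchur_neg_one (by simp)]
  · simp [opX_fourSchur_zero]
    ring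
  · exact fun j _ => opX_fourSchur_of_lt (by push_cast; omega)

theorem schurPositive_opXCol {a b c : ℤ} {d : ℕ} (h1 : b ≤ a) (h2 : c ≤ b) (h3 : (d : ℤ) ≤ c)
    {N : ℕ} (hN : d + 2 ≤ N) {e : ℤ} (he : e = d) : SchurPositive n (opXCol n N a b c e) :=
  schurPositive_sum_opX h1 h2 h3 hN he

theorem schurPositive_opXCol_lines (n k : ℕ) (hk : 1 ≤ k) : SchurPositive n
    (opXCol n (k + 3) k (k - 1) k (k - 1) + opXCol n (k + 3) (k + 1) (k - 1) (k - 1) (k - 1) -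
      commonPart n k) :=
  schurPositive_sum_opX_lines n k hk

theorem schurPositive_hookRow_sq_sub_mul_sub_two (n k : ℕ) (hk : 2 ≤ k) : SchurPositive n
    (hookRow (hInt n) k (k - 1) ^ 2 - hookRow (hInt n) k k * hookRow (hInt n) k (k - 2) -
      commonPart n k) := by
  have hl := schurPositive_opXCol_lines n k (by omega)
  obtain ⟨N, hN⟩ : ∃ N, N = k + 3 := ⟨_, rfl⟩
  rw [← hN] at hl
  have h := diff24_eq_sum (vanishesBelow_twoRowProd.opX (hInt n 1))
    antisymm12_crossDiff_opX antisymm34_crossDiff_opX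
    (a := k) (b := k - 1) (c := k) (d := k - 1) (f := 1) (N := N)
    (by simp) (by simp) (by omega)
  have h2 : ∀ j : ℕ, ∑ t ∈ Finset.range N, opX (hInt n 1) (fourSchur n) (k + j)
      (k - 1 + j + 1 + 2 + t) (k - j - 1 - 2 - t) (k - 1 - j) =
      opXCol n N (k + j + 1) (k + j + 1) (k - j - 2) (k - j - 2) := fun j => by
    refine Finset.sum_congr rfl fun t _ => ?_
    rw [fourSchur_antisymm12.opX, fourSchur_antisymm34.opX, neg_neg]
    ring_nf
  rw [crossDiff_opX, crossDiff_twoRowProd, diff24, opX_twoRowProd, opX_twoRowProd] at h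
  have hcol : ∀ a b c d : ℤ, ∑ j ∈ Finset.range N, opX (hInt n 1) (fourSchur n) (a + j) b c (d - j) =
    opXCol n N a b c d := fun _ _ _ _ => rfl
  simp only [Finset.sum_range_succ _ 1, Finset.sum_range_one, Nat.reduceSub, Nat.sub_zero,
    add_zero, sub_zero, Nat.reduceAdd,
    Nat.cast_zero, Nat.cast_one, h2, hcol, sub_add_cancel] at h
  rw [sq, show (k : ℤ) - 2 = k - 1 - 1 by ring, h]
  have hs : SchurPositive n
      (∑ j ∈ Finset.range N, opXCol n N (k + j + 1) (k + j + 1) (k - j - 2) (k - j - 2)) := by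
    refine SchurPositive.sum fun j _ => ?_
    rcases lt_trichotomy (j + 1) k with hj | hj | hj
    · exact schurPositive_opXCol (d := k - (j + 2)) le_rfl (by omega) (by omega) (by omega)
        (by omega)
    · rw [show (k : ℤ) - j - 2 = -1 by omega, opXCol_neg_one_neg_one]
      exact schurPositive_zero
    · rw [opXCol_of_lt (by omega)]
      exact schurPositive_zero
  have hm : SchurPositive n (opXCol n N k k (k - 1) (k - 1)) :=
    schurPositive_opXCol (d := k - 1) le_rfl (by omega) (by omega) (by omega) (by omega)
  convert (hl.add hm).add hs using 1
  ring

theorem schurPositive_hookRow_sq_sub_mul_sub_one (n k : ℕ) (hk : 2 ≤ k) : SchurPositive n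
    (hookRow (hInt n) k (k - 1) ^ 2 - hookRow (hInt n) k k * hookRow (hInt n) (k - 1) (k - 1) -
      commonPart n k) := by
  have hl := schurPositive_opXCol_lines n k (by omega)
  obtain ⟨N, hN⟩ : ∃ N, N = k + 3 := ⟨_, rfl⟩
  obtain ⟨q, hq⟩ : ∃ q, k = q + 2 := ⟨k - 2, by omega⟩
  rw [← hN] at hl
  have h := diff23_eq_sum (vanishesBelow_twoRowProd.opX (hInt n 1))
    antisymm12_crossDiff_opX antisymm34_crossDiff_opX
    (a := k) (b := k - 1) (c := k) (d := k - 1) (e := 1) (f := 1) (N := N)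
    (by simp) (by simp) (by omega)
  rw [crossDiff_opX, crossDiff_twoRowProd, diff23, opX_twoRowProd, opX_twoRowProd,
    sub_add_cancel, ← sq] at h
  set G : ℕ → ℕ → MvPolynomial (Fin n) ℚ := fun l i =>
    opXCol n N (k + i) (k - 1 + l) (k - i) (k - 1 - l) with hG
  set T : ℕ → MvPolynomial (Fin n) ℚ := fun l =>
    ∑ i ∈ Finset.range (l + 1 + 1), if l ≤ i + 1 then G l i else 0 with hT
  have hsum : hookRow (hInt n) k (k - 1) ^ 2 -
      hookRow (hInt n) k k * hookRow (hInt n) (k - 1) (k - 1) = ∑ l ∈ Finset.range N, T l := by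
    rw [h]
    refine Finset.sum_congr rfl fun l _ => Finset.sum_congr rfl fun i _ => if_congr Iff.rfl ?_ rfl
    exact Finset.sum_congr rfl fun j _ => by rw [sub_right_comm]
  have hGpos : ∀ l i : ℕ, 1 ≤ l → l + 1 ≤ k → l ≤ i + 1 → i ≤ l + 1 → SchurPositive n (G l i) :=
    fun l i h1 h2 h3 h4 => schurPositive_opXCol (d := k - 1 - l) (by omega) (by omega) (by omega)
      (by omega) (by omega)
  have hT0 : T 0 = opXCol n N k (k - 1) k (k - 1) +
      opXCol n N (k + 1) (k - 1) (k - 1) (k - 1) := by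
    simp [hT, hG, Finset.sum_range_succ]
  have hTpos : ∀ l, 1 ≤ l → l + 2 ≤ k → SchurPositive n (T l) := fun l h1 h2 => by
    refine SchurPositive.sum fun i hi => ?_
    have := Finset.mem_range.1 hi
    split_ifs with hli
    · exact hGpos l i h1 (by omega) hli (by omega)
    · exact schurPositive_zero
  have hTk : ∀ l, k + 1 ≤ l → T l = 0 := fun l hl => Finset.sum_eq_zero fun i _ => by
    rw [hG]
    dsimp only
    rw [opXCol_of_lt (by omega), ite_self]
  have hTl : ∀ l, T (l + 1) = G (l + 1) l + G (l + 1) (l + 1) + G (l + 1) (l + 2) := fun l => by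
    rw [hT]
    dsimp only
    rw [Finset.sum_range_succ, Finset.sum_range_succ, Finset.sum_range_succ, Finset.sum_eq_zero]
    · simp
    · intro i hi
      have := Finset.mem_range.1 hi
      rw [if_neg (by omega)]
  have hpair : ∀ i : ℕ, G (q + 1) i + G (q + 2) i = 0 := fun i => by
    have := opXCol_zero_add_opXCol_neg_one (n := n) (k + 1) (k + i) (k + q) (k - i)
    rw [hG]
    dsimp only
    rw [hN]
    convert this using 3 <;> push_cast [hq] <;> ring
  have hcorner : G (q + 2) (q + 3) = 0 := by
    have := opXCol_neg_one_neg_one (n := n) N (k + (q + 3)) (k + (q + 1))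
    rw [hG]
    dsimp only
    rw [← this]
    congr 1 <;> push_cast [hq] <;> ring
  have hsplit : ∑ l ∈ Finset.range N, T l =
      T 0 + ∑ l ∈ Finset.range q, T (l + 1) + G (q + 1) q := by
    rw [hN, hq, show q + 2 + 3 = q + 1 + 1 + 1 + 1 + 1 by ring, Finset.sum_range_succ,
      Finset.sum_range_succ, Finset.sum_range_succ, Finset.sum_range_succ, Finset.sum_range_succ',
      hTk (q + 1 + 1 + 1 + 1) (by omega), hTk (q + 1 + 1 + 1) (by omega), hTl (q + 1), hTl q]
    linear_combination hpair (q + 1) + hpair (q + 2) + hcorner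
  rw [hsum, hsplit, hT0]
  have hs : SchurPositive n (∑ l ∈ Finset.range q, T (l + 1)) := SchurPositive.sum fun l hl' => by
    have := Finset.mem_range.1 hl'
    exact hTpos _ (by omega) (by omega)
  convert (hl.add hs).add (hGpos (q + 1) q (by omega) (by omega) (by omega) (by omega)) using 1
  ring

end Products

section Derivative

variable {n : ℕ}

/-- The derivation `∑ i, ∂/∂x_i`, the infinitesimal generator of the diagonal shift. -/
def shiftDeriv (n : ℕ) : Derivation ℚ (MvPolynomial (Fin n) ℚ) (MvPolynomial (Fin n) ℚ) :=
  ∑ i, pderiv i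

theorem shiftDeriv_apply (p : MvPolynomial (Fin n) ℚ) :
    shiftDeriv n p = ∑ i, pderiv i p := by
  rw [shiftDeriv, ← Derivation.coeFnAddMonoidHom_apply, map_sum, Finset.sum_apply]
  rfl

theorem shiftDeriv_X (j : Fin n) : shiftDeriv n (X j) = 1 := by
  classical
  simp [shiftDeriv_apply, pderiv_X, Pi.single_apply]

theorem derived_coeffs (p : MvPolynomial (Fin n) ℚ) :
    derived n 0 p = p ∧ derived n 1 p = shiftDeriv n p ∧
      2 * derived n 2 p = shiftDeriv n (shiftDeriv n p) := by
  induction p using MvPolynomial.induction_on with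
  | C a =>
    have : shiftDeriv n (C a) = 0 := Derivation.map_algebraMap _ _
    simp [derived, this, Polynomial.algebraMap_apply, Polynomial.coeff_C]
  | add p q hp hq =>
    simp only [derived, map_add, Polynomial.coeff_add, mul_add] at hp hq ⊢
    rw [hp.1, hp.2.1, hp.2.2, hq.1, hq.2.1, hq.2.2]
    exact ⟨rfl, rfl, rfl⟩
  | mul_X p j hp =>
    have h : ∀ i, derived n (i + 1) (p * X j) = derived n (i + 1) p * X j + derived n i p :=
      fun i => by simp [derived, mul_add, Polynomial.coeff_mul_X]
    have h0 : derived n 0 (p * X j) = derived n 0 p * X j := by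
      simp [derived, mul_add]
    refine ⟨by rw [h0, hp.1], ?_, ?_⟩
    · rw [h 0, hp.1, hp.2.1, Derivation.leibniz, shiftDeriv_X]
      simp [mul_comm, add_comm]
    · rw [h 1, mul_add, ← mul_assoc, hp.2.2, hp.2.1]
      simp only [Derivation.leibniz, shiftDeriv_X, map_add, smul_eq_mul, mul_one]
      ring

theorem derived_one (p : MvPolynomial (Fin n) ℚ) : derived n 1 p = shiftDeriv n p :=
  (derived_coeffs p).2.1

theorem two_mul_derived_two (p : MvPolynomial (Fin n) ℚ) :
    2 * derived n 2 p = shiftDeriv n (shiftDeriv n p) := (derived_coeffs p).2.2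

theorem prod_map_X (s : Multiset (Fin n)) :
    (s.map (X : Fin n → MvPolynomial (Fin n) ℚ)).prod = monomial (Multiset.toFinsupp s) 1 := by
  induction s using Multiset.induction_on with
  | empty => simp
  | cons a s ih =>
    rw [Multiset.map_cons, Multiset.prod_cons, ih, ← Multiset.singleton_add, map_add,
      Multiset.toFinsupp_singleton, X, monomial_mul, one_mul]

theorem coeff_hsymm (k : ℕ) (m : Fin n →₀ ℕ) :
    coeff m (hsymm (Fin n) ℚ k) = if m.degree = k then 1 else 0 := by
  classical
  have hs (s : Sym (Fin n) k) :
      Multiset.toFinsupp (s : Multiset (Fin n)) = m ↔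
        (s : Multiset (Fin n)) = Finsupp.toMultiset m :=
    Multiset.toFinsupp.toEquiv.eq_symm_apply.symm
  have hc : (Finsupp.toMultiset m).card = m.degree := Finsupp.card_toMultiset m
  have hsum : coeff m (hsymm (Fin n) ℚ k) =
      ∑ s : Sym (Fin n) k, if (s : Multiset (Fin n)) = Finsupp.toMultiset m then 1 else 0 := by
    rw [hsymm, coeff_sum]
    refine Finset.sum_congr rfl fun s _ => ?_
    refine (congrArg (coeff m) (prod_map_X (s : Multiset (Fin n)))).trans ?_
    simp only [coeff_monomial, hs]
  rw [hsum]
  split_ifs with h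
  · rw [Finset.sum_eq_single (Sym.mk (Finsupp.toMultiset m) (hc.trans h))]
    · exact if_pos rfl
    · exact fun s _ hne => if_neg fun h' => hne (Sym.coe_injective h')
    · exact fun h' => absurd (Finset.mem_univ _) h'
  · exact Finset.sum_eq_zero fun s _ => if_neg fun h' => h (by rw [← hc, ← h']; exact s.2)

theorem shiftDeriv_hsymm (k : ℕ) :
    shiftDeriv n (hsymm (Fin n) ℚ (k + 1)) =
      ((n + k : ℕ) : MvPolynomial (Fin n) ℚ) * hsymm (Fin n) ℚ k := by
  ext m
  rw [← nsmul_eq_mul, coeff_smul, coeff_hsymm]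
  simp only [shiftDeriv_apply, coeff_sum, coeff_pderiv, coeff_hsymm,
    map_add, Finsupp.degree_single, add_left_inj]
  split_ifs with h
  · rw [← h, Finsupp.degree_eq_sum]
    simp [Finset.sum_add_distrib, add_comm]
  · simp

theorem shiftDeriv_hInt (k : ℤ) :
    shiftDeriv n (hInt n k) = ((n + k - 1 : ℤ) : MvPolynomial (Fin n) ℚ) * hInt n (k - 1) := by
  rcases lt_trichotomy k 0 with h | rfl | h
  · rw [hInt_of_neg h, hInt_of_neg (by omega), map_zero, mul_zero]
  · rw [hInt_zero, hInt_of_neg (by omega), Derivation.map_one_eq_zero, mul_zero]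
  · obtain ⟨j, rfl⟩ : ∃ j : ℕ, k = j + 1 := ⟨(k - 1).toNat, by omega⟩
    have h1 : hInt n (j + 1 : ℤ) = hsymm (Fin n) ℚ (j + 1) := by
      rw [hInt, if_pos (by omega)]; rfl
    have h2 : hInt n (j + 1 - 1 : ℤ) = hsymm (Fin n) ℚ j := by
      rw [hInt, if_pos (by omega), add_sub_cancel_right]; rfl
    rw [h1, h2, shiftDeriv_hsymm]
    push_cast
    ring

theorem shiftDeriv_twoRow (a b : ℤ) : shiftDeriv n (twoRow (hInt n) a b) =
    ((n + a - 1 : ℤ) : MvPolynomial (Fin n) ℚ) * twoRow (hInt n) (a - 1) b +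
      ((n + b - 2 : ℤ) : MvPolynomial (Fin n) ℚ) * twoRow (hInt n) a (b - 1) := by
  simp only [twoRow, map_sub, Derivation.leibniz, shiftDeriv_hInt, smul_eq_mul,
    add_sub_cancel_right, sub_add_cancel]
  push_cast
  ring

theorem shiftDeriv_hookRow (a b : ℤ) : shiftDeriv n (hookRow (hInt n) a b) =
    ((n + a - 1 : ℤ) : MvPolynomial (Fin n) ℚ) * hookRow (hInt n) (a - 1) b +
      ((n + b - 2 : ℤ) : MvPolynomial (Fin n) ℚ) * hookRow (hInt n) a (b - 1) +
      ((n - 2 : ℤ) : MvPolynomial (Fin n) ℚ) * twoRow (hInt n) a b := by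
  simp only [hookRow, map_sub, Derivation.leibniz, shiftDeriv_twoRow, shiftDeriv_hInt, smul_eq_mul,
    add_sub_cancel_right, sub_add_cancel, sub_self, hInt_zero]
  push_cast
  ring

end Derivative

theorem hookRow_eq_zero {n : ℕ} {k b : ℤ} (h : b = k + 1) : hookRow (hInt n) k b = 0 := by
  subst h
  simp only [hookRow, twoRow]
  ring_nf

theorem schur_eq_hookRow (n k : ℕ) (hk : 1 ≤ k) :
    schur n (fun i => if i < 2 then k else if i = 2 then 1 else 0) = hookRow (hInt n) k k := by
  have hμ : Antitone fun i => if i < 2 then k else if i = 2 then 1 else 0 := by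
    intro i j hij
    dsimp only
    split_ifs <;> omega
  rw [schur_eq_det (N := 3) (fun i hi => by
      simp only [if_neg (show ¬i < 2 by omega), if_neg (show ¬i = 2 by omega)]) hμ,
    Matrix.det_fin_three, hookRow, twoRow_eq_zero (b := k + 1) rfl]
  simp only [jacobiTrudi, twoRow, Matrix.of_apply]
  simp
  ring_nf
  simp only [hInt_zero, hInt_of_neg (show (-1 : ℤ) < 0 by norm_num)]
  ring

/-- The difference in the main theorem as a combination of Schur positive quadratic expressions. -/
theorem hookRow_turan_eq (n k : ℕ) :
    2 * (derived n 1 (hookRow (hInt n) k k) ^ 2 -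
        hookRow (hInt n) k k * derived n 2 (hookRow (hInt n) k k)) =
      ((n + k - 2 : ℤ) * (n + k - 1 : ℤ) : MvPolynomial (Fin n) ℚ) *
          (hookRow (hInt n) k (k - 1) ^ 2 -
            hookRow (hInt n) k k * hookRow (hInt n) (k - 1) (k - 1) - commonPart n k) +
        ((n + k - 2 : ℤ) * (n + k - 3 : ℤ) : MvPolynomial (Fin n) ℚ) *
          (hookRow (hInt n) k (k - 1) ^ 2 -
            hookRow (hInt n) k k * hookRow (hInt n) k (k - 2) - commonPart n k) +
        (2 * (n + k - 2 : ℤ) * (n - 2 : ℤ) : MvPolynomial (Fin n) ℚ) *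
          (hookRow (hInt n) k (k - 1) * twoRow (hInt n) k k) +
        (2 * (n - 2 : ℤ) ^ 2 : MvPolynomial (Fin n) ℚ) *
          (twoRow (hInt n) k k ^ 2 - commonPart n k) +
        (2 * ((n + k - 2) ^ 2 - (n + k - 2) * (n - 2) + (n - 2) ^ 2 : ℤ) :
          MvPolynomial (Fin n) ℚ) * commonPart n k := by
  have hL : shiftDeriv n (hookRow (hInt n) k k) =
      ((n + k - 2 : ℤ) : MvPolynomial (Fin n) ℚ) * hookRow (hInt n) k (k - 1) +
        ((n - 2 : ℤ) : MvPolynomial (Fin n) ℚ) * twoRow (hInt n) k k := by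
    rw [shiftDeriv_hookRow, hookRow_eq_zero (k := (k : ℤ) - 1) (by ring), mul_zero, zero_add]
  have hB : shiftDeriv n (twoRow (hInt n) k k) =
      ((n + k - 2 : ℤ) : MvPolynomial (Fin n) ℚ) * twoRow (hInt n) k (k - 1) := by
    rw [shiftDeriv_twoRow, twoRow_eq_zero (k := (k : ℤ) - 1) (by ring), mul_zero, zero_add]
  have hA := shiftDeriv_hookRow (n := n) (k : ℤ) (k - 1)
  rw [show (k : ℤ) - 1 - 1 = k - 2 by ring] at hA
  have hint (z : ℤ) (p : MvPolynomial (Fin n) ℚ) :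
      shiftDeriv n ((z : MvPolynomial (Fin n) ℚ) * p) = z * shiftDeriv n p := by
    rw [← zsmul_eq_mul, map_zsmul, zsmul_eq_mul]
  rw [mul_sub, mul_left_comm, two_mul_derived_two, derived_one, hL, map_add, hint, hint, hA, hB]
  push_cast
  linear_combination (-2 * (n + k - 2) * (n - 2) : MvPolynomial (Fin n) ℚ) *
    hookRow_mul_twoRow_sub n k

/-- for `λ = (k, k, 1)` with `k ≥ 3` and `n ≥ 3` variables,
`(s_λ^{(1)})^2 - s_λ * s_λ^{(2)}` is Schur positive. -/
theorem kk1_schur_positive (k n : ℕ) (hk : 3 ≤ k) (hn : 3 ≤ n) :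
    SchurPositive n
      ((derived n 1 (schur n (fun i => if i < 2 then k else if i = 2 then 1 else 0))) ^ 2 -
        schur n (fun i => if i < 2 then k else if i = 2 then 1 else 0) *
          derived n 2 (schur n (fun i => if i < 2 then k else if i = 2 then 1 else 0))) := by
  have hnq : (3 : ℚ) ≤ n := by exact_mod_cast hn
  have hkq : (3 : ℚ) ≤ k := by exact_mod_cast hk
  rw [schur_eq_hookRow n k (by omega)]
  have key := ((((((schurPositive_hookRow_sq_sub_mul_sub_one n k (by omega)).smul
      (r := ((n + k - 2) * (n + k - 1) : ℚ)) (mul_nonneg (by linarith) (by linarith))).add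
    ((schurPositive_hookRow_sq_sub_mul_sub_two n k (by omega)).smul
      (r := ((n + k - 2) * (n + k - 3) : ℚ)) (mul_nonneg (by linarith) (by linarith)))).add
    ((schurPositive_hookRow_mul_twoRow n k (by omega)).smul
      (r := (2 * (n + k - 2) * (n - 2) : ℚ)) (mul_nonneg (by linarith) (by linarith)))).add
    ((schurPositive_twoRow_sq_sub n k).smul
      (r := (2 * (n - 2) ^ 2 : ℚ)) (by positivity))).add
    ((schurPositive_commonPart n k).smul
      (r := (2 * ((n + k - 2) ^ 2 - (n + k - 2) * (n - 2) + (n - 2) ^ 2) : ℚ))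
      (by nlinarith [sq_nonneg ((n + k - 2 : ℚ) - (n - 2))]))).smul
    (r := (2⁻¹ : ℚ)) (by norm_num)
  have hhalf : C 2⁻¹ * 2 = (1 : MvPolynomial (Fin n) ℚ) := by
    rw [← map_ofNat (C : ℚ →+* MvPolynomial (Fin n) ℚ) 2, ← C_mul]
    norm_num
  convert key using 1
  have h := hookRow_turan_eq n k
  rw [smul_eq_C_mul]
  simp only [smul_eq_C_mul, map_mul, map_add, map_sub, map_pow, map_natCast, map_one, map_ofNat]
  push_cast at h
  rw [← h, ← mul_assoc, hhalf, one_mul]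

end
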